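/- Let ω ⊂ ℝ² be a bounded, connected, open set, let r₀ ≥ 1 and r_f ≥ 1 with r := r_f/r₀ ≠ 1, and let μ > 0 and τ > 0. Let y : ℝ² → ℝ³ be three times continuously differentiable on an open neighborhood of the closure of ω, and let n₀ : ℝ² → ℝ³ be twice continuously differentiable on an open neighborhood of the closure of ω with |n₀(x̃)| = 1 for all x̃, and assume that the 3×2 Jacobian matrix ∇̃y := (∂₁y | ∂₂y) satisfies the metric constraint (∇̃y)ᵀ∇̃y = ℓ̃_{n₀} at every point of ω, where ℓ̃ is taken with parameter r. Then there exist constants C > 0 and h₀ > 0 such that for every h ∈ (0, h₀) there is a map Y^h : ℝ³ → ℝ³, continuously differentiable on an open neighborhood of the closure of Ω_h := ω × (−h/2, h/2), with: (i) Y^h(x̃, 0) = y(x̃) for all x̃ ∈ ω; (ii) det ∇Y^h = 1 everywhere on Ω_h; and (iii) for every measurable map N₀^h : Ω_h → ℝ³ with |N₀^h| = 1 a.e. and ess sup_{Ω_h} |N₀^h − n₀| ≤ τh, the entropic energy satisfies ∫_{Ω_h} W^e( ∇Y^h(x), (∇Y^h(x)) N₀^h(x) / |(∇Y^h(x)) N₀^h(x)|,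 N₀^h(x) ) dx ≤ C h³ (note (∇Y^h)N₀^h ≠ 0 since ∇Y^h is invertible). -/

import Mathlib

open Matrix MeasureTheory

noncomputable section

/-- `v` is a unit vector in `ℝ³`. -/
def unit3 (v : Fin 3 → ℝ) : Prop := ∑ i, (v i) ^ 2 = 1

/-- Outer product `u ⊗ v` of vectors in `ℝ³`. -/
def outer3 (u v : Fin 3 → ℝ) : Matrix (Fin 3) (Fin 3) ℝ := Matrix.of fun i j => u i * v j

/-- Step-length tensor `ℓ_ν = r^{-1/3}(I₃ + (r-1) ν ⊗ ν)`. -/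
def ell (r : ℝ) (v : Fin 3 → ℝ) : Matrix (Fin 3) (Fin 3) ℝ :=
  r ^ (-(1/3) : ℝ) • (1 + (r - 1) • outer3 v v)

/-- Entropic energy density (finite branch):
`W^e(F,ν,ν₀) = (μ/2)(Tr(Fᵀ (ℓ^f_ν)⁻¹ F ℓ⁰_{ν₀}) - 3)`. -/
def We (μ rf r0 : ℝ) (F : Matrix (Fin 3) (Fin 3) ℝ) (ν ν₀ : Fin 3 → ℝ) : ℝ :=
  μ / 2 * (Matrix.trace (Fᵀ * (ell rf ν)⁻¹ * F * ell r0 ν₀) - 3)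

/-- Normalization `v / |v|` of a vector in `ℝ³`. -/
def nvec (v : Fin 3 → ℝ) : Fin 3 → ℝ := fun i => v i / Real.sqrt (∑ j, (v j) ^ 2)

/-- Two-dimensional tensor `ℓ̃_ν = r^{-1/3}(I₂ + (r-1) ν̃ ⊗ ν̃)`. -/
def ellT (r : ℝ) (v : Fin 3 → ℝ) : Matrix (Fin 2) (Fin 2) ℝ :=
  r ^ (-(1/3) : ℝ) • (1 + (r - 1) • Matrix.of (fun i j : Fin 2 => v i.castSucc * v j.castSucc))

/-- Planar Jacobian `∇̃y = (∂₁y | ∂₂y) ∈ ℝ^{3×2}` of a map `y : ℝ² → ℝ³`. -/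
def jac32 (y : (Fin 2 → ℝ) → Fin 3 → ℝ) (x : Fin 2 → ℝ) : Matrix (Fin 3) (Fin 2) ℝ :=
  Matrix.of fun i j => fderiv ℝ y x (Pi.single j 1) i

/-- Full Jacobian `∇Y ∈ ℝ^{3×3}` of a map `Y : ℝ³ → ℝ³`. -/
def jac3 (Y : (Fin 3 → ℝ) → Fin 3 → ℝ) (x : Fin 3 → ℝ) : Matrix (Fin 3) (Fin 3) ℝ :=
  Matrix.of fun i j => fderiv ℝ Y x (Pi.single j 1) i

/-- Planar projection `xt = (x₁, x₂)` of a point `x ∈ ℝ³`. -/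
def proj2 (x : Fin 3 → ℝ) : Fin 2 → ℝ := fun j => x j.castSucc

/-- The point `(xt, c) ∈ ℝ³`. -/
def emb (xt : Fin 2 → ℝ) (c : ℝ) : Fin 3 → ℝ :=
  fun i => if h : (i : ℕ) < 2 then xt ⟨i, h⟩ else c

/-- The thin sheet `Ω_h = ω × (-h/2, h/2)`. -/
def slab (ω : Set (Fin 2 → ℝ)) (h : ℝ) : Set (Fin 3 → ℝ) :=
  {x | proj2 x ∈ ω ∧ x 2 ∈ Set.Ioo (-(h / 2)) (h / 2)}

lemma ell_inv_mul {r : ℝ} (hr : 0 < r) {n : Fin 3 → ℝ} (hn : unit3 n) :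
    (r ^ (1/3 : ℝ) • (1 - (1 - 1 / r) • outer3 n n)) * ell r n = 1 := by
  have h1 : r ^ (1/3 : ℝ) * r ^ (-(1/3) : ℝ) = 1 := by
    rw [← Real.rpow_add hr]; norm_num
  unfold ell
  rw [Matrix.smul_mul, Matrix.mul_smul, smul_smul, h1, one_smul]
  have ho : outer3 n n * outer3 n n = outer3 n n := by
    ext i j
    simp only [outer3, Matrix.mul_apply, Matrix.of_apply]
    have : ∀ k, n i * n k * (n k * n j) = n i * n j * (n k) ^ 2 := fun k => by ring
    simp only [this, ← Finset.mul_sum]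
    rw [hn, mul_one]
  rw [sub_mul, mul_add, mul_add, Matrix.smul_mul, Matrix.smul_mul, Matrix.mul_smul, Matrix.mul_smul, ho]
  simp only [one_mul, mul_one, smul_smul]
  have : (r - 1) - (1 - 1 / r) - (1 - 1/r) * (r - 1) = 0 := by field_simp; ring
  have h2 : (1 : Matrix (Fin 3) (Fin 3) ℝ) + (r - 1) • outer3 n n - ((1 - 1 / r) • outer3 n n + ((1 - 1 / r) * (r - 1)) • outer3 n n) = 1 + ((r - 1) - (1 - 1 / r) - (1 - 1/r) * (r - 1)) • outer3 n n := by
    simp only [sub_smul]; abel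
  rw [h2, this]; simp

lemma ell_inv {r : ℝ} (hr : 0 < r) {n : Fin 3 → ℝ} (hn : unit3 n) :
    (ell r n)⁻¹ = r ^ (1/3 : ℝ) • (1 - (1 - 1 / r) • outer3 n n) :=
  Matrix.inv_eq_left_inv (ell_inv_mul hr hn)

lemma det_ell {r : ℝ} (hr : 0 < r) {n : Fin 3 → ℝ} (hn : unit3 n) : (ell r n).det = 1 := by
  have h3 : (r ^ (-(1/3) : ℝ)) ^ 3 = 1 / r := by
    rw [← Real.rpow_natCast, ← Real.rpow_mul hr.le]; norm_num [Real.rpow_neg_one]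
  unfold ell
  rw [Matrix.det_smul, Fintype.card_fin, h3]
  have hn' : n 0 ^ 2 + n 1 ^ 2 + n 2 ^ 2 = 1 := by
    have := hn; unfold unit3 at this; rwa [Fin.sum_univ_three] at this
  have : (1 + (r - 1) • outer3 n n).det = 1 + (r - 1) * (n 0 ^ 2 + n 1 ^ 2 + n 2 ^ 2) := by
    rw [Matrix.det_fin_three]; simp [outer3]; ring
  rw [this, hn']; field_simp; ring

lemma trace_expand (F : Matrix (Fin 3) (Fin 3) ℝ) (ν n : Fin 3 → ℝ) (k s : ℝ) :
    Matrix.trace (Fᵀ * (1 - k • outer3 ν ν) * F * (1 + s • outer3 n n)) =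
      (Fᵀ * F).trace + s * ∑ i, (F *ᵥ n) i ^ 2
        - k * (∑ i, (Fᵀ *ᵥ ν) i ^ 2 + s * (∑ i, ν i * (F *ᵥ n) i) ^ 2) := by
  simp only [Matrix.trace, Matrix.mul_apply, Matrix.mulVec, dotProduct, Fin.sum_univ_three, outer3,
    Matrix.transpose_apply, Matrix.sub_apply, Matrix.add_apply, Matrix.smul_apply, Matrix.of_apply,
    Matrix.one_apply, Matrix.diag_apply, smul_eq_mul]
  simp
  ring

lemma sum_sq_pos {v : Fin 3 → ℝ} (hv : v ≠ 0) : 0 < ∑ j, (v j) ^ 2 := by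
  obtain ⟨i, hi⟩ := Function.ne_iff.1 hv
  exact Finset.sum_pos' (fun j _ => sq_nonneg _) ⟨i, Finset.mem_univ _, by
    have : v i ≠ 0 := hi
    positivity⟩

lemma unit3_nvec {v : Fin 3 → ℝ} (hv : v ≠ 0) : unit3 (nvec v) := by
  have h := sum_sq_pos hv
  unfold unit3 nvec
  simp only [div_pow, Real.sq_sqrt h.le]
  rw [← Finset.sum_div]; exact div_self h.ne'

lemma sum_nvec_mul_sq (v : Fin 3 → ℝ) : (∑ i, nvec v i * v i) ^ 2 = ∑ i, v i ^ 2 := by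
  have h : 0 ≤ ∑ j, (v j) ^ 2 := Finset.sum_nonneg fun j _ => sq_nonneg _
  have : ∀ i, nvec v i * v i = v i ^ 2 / Real.sqrt (∑ j, (v j) ^ 2) := fun i => by
    unfold nvec; ring
  simp only [this]
  rw [← Finset.sum_div, Real.div_sqrt, Real.sq_sqrt h]

/-- When the current director is convected by `F`, the entropic energy is at most that of the
effective step-length tensor with parameter `r_f / r₀`. -/
lemma We_le {μ rf r0 : ℝ} (hμ : 0 < μ) (hrf : 1 ≤ rf) (hr0 : 1 ≤ r0)
    {F : Matrix (Fin 3) (Fin 3) ℝ} (hF : F.det = 1) {n : Fin 3 → ℝ} (hn : unit3 n) :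
    We μ rf r0 F (nvec (F *ᵥ n)) n ≤
      μ / 2 * (Matrix.trace ((ell (rf / r0) n)⁻¹ * (Fᵀ * F)) - 3) := by
  have hrf0 : 0 < rf := by linarith
  have hr00 : 0 < r0 := by linarith
  have hn0 : n ≠ 0 := by
    rintro rfl; simp [unit3] at hn
  have hv : F *ᵥ n ≠ 0 := fun h => hn0 (Matrix.eq_zero_of_mulVec_eq_zero (by rw [hF]; simp) h)
  set ν := nvec (F *ᵥ n) with hν
  have hνu : unit3 ν := unit3_nvec hv
  rw [We, ell_inv hrf0 hνu, ell_inv (div_pos hrf0 hr00) hn, ell]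
  gcongr μ / 2 * (?_ - 3)
  simp only [Matrix.mul_smul, Matrix.smul_mul, Matrix.trace_smul, smul_eq_mul]
  rw [trace_expand, ← mul_assoc, sum_nvec_mul_sq]
  have hpre : r0 ^ (-(1/3) : ℝ) * rf ^ (1/3 : ℝ) = (rf / r0) ^ (1/3 : ℝ) := by
    rw [Real.div_rpow hrf0.le hr00.le, Real.rpow_neg hr00.le]; ring
  rw [hpre]
  have htr : Matrix.trace ((1 - (1 - 1 / (rf / r0)) • outer3 n n) * (Fᵀ * F)) =
      (Fᵀ * F).trace - (1 - 1 / (rf / r0)) * ∑ i, (F *ᵥ n) i ^ 2 := by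
    simp only [Matrix.trace, Matrix.mul_apply, Matrix.mulVec, dotProduct, Fin.sum_univ_three,
      outer3, Matrix.transpose_apply, Matrix.sub_apply, Matrix.smul_apply, Matrix.of_apply,
      Matrix.one_apply, Matrix.diag_apply, smul_eq_mul]
    simp
    ring
  rw [htr]
  have hcs : ∑ i, (F *ᵥ n) i ^ 2 ≤ ∑ i, (Fᵀ *ᵥ ν) i ^ 2 := by
    have h1 := Finset.sum_mul_sq_le_sq_mul_sq Finset.univ (Fᵀ *ᵥ ν) n
    rw [show ∑ i, n i ^ 2 = 1 from hn, mul_one] at h1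
    have h2 : ∑ i, (Fᵀ *ᵥ ν) i * n i = ∑ i, ν i * (F *ᵥ n) i := by
      simp only [Matrix.mulVec, dotProduct, Fin.sum_univ_three, Matrix.transpose_apply]; ring
    rw [h2, sum_nvec_mul_sq] at h1
    exact h1
  have hk : 0 ≤ 1 - 1 / rf := by
    rw [sub_nonneg, div_le_one hrf0]; exact hrf
  refine mul_le_mul_of_nonneg_left ?_ (by positivity)
  set a := ∑ i, (F *ᵥ n) i ^ 2
  have h4 : (r0 - 1) * a - (1 - 1 / rf) * (a + (r0 - 1) * a) = - (1 - 1 / (rf / r0)) * a := by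
    field_simp; ring
  nlinarith [mul_le_mul_of_nonneg_left hcs hk]

lemma trace_le_of_det_one_add {M : Matrix (Fin 3) (Fin 3) ℝ} {K : ℝ} (hK : 0 ≤ K)
    (hM : ∀ i j, |M i j| ≤ K) (hdet : (1 + M).det = 1) : M.trace ≤ 6 * K ^ 2 + 6 * K ^ 3 := by
  rw [Matrix.det_fin_three] at hdet
  simp at hdet
  rw [Matrix.trace_fin_three]
  have h2 : ∀ i j k l, |M i j * M k l| ≤ K ^ 2 := fun i j k l => by
    rw [abs_mul, sq]; exact mul_le_mul (hM _ _) (hM _ _) (abs_nonneg _) hK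
  have h3 : ∀ i j k l m o, |M i j * M k l * M m o| ≤ K ^ 3 := fun i j k l m o => by
    rw [abs_mul, pow_succ]; exact mul_le_mul (h2 _ _ _ _) (hM _ _) (abs_nonneg _) (by positivity)
  have e1 := abs_le.1 (h2 0 0 1 1)
  have e2 := abs_le.1 (h2 0 0 2 2)
  have e3 := abs_le.1 (h2 1 1 2 2)
  have e4 := abs_le.1 (h2 0 1 1 0)
  have e5 := abs_le.1 (h2 0 2 2 0)
  have e6 := abs_le.1 (h2 1 2 2 1)
  have f1 := abs_le.1 (h3 0 0 1 1 2 2)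
  have f2 := abs_le.1 (h3 0 0 1 2 2 1)
  have f3 := abs_le.1 (h3 0 1 1 0 2 2)
  have f4 := abs_le.1 (h3 0 1 1 2 2 0)
  have f5 := abs_le.1 (h3 0 2 1 0 2 1)
  have f6 := abs_le.1 (h3 0 2 1 1 2 0)
  nlinarith

lemma abs_mul_apply_le {A B : Matrix (Fin 3) (Fin 3) ℝ} {a b : ℝ} (ha : 0 ≤ a)
    (hA : ∀ i j, |A i j| ≤ a) (hB : ∀ i j, |B i j| ≤ b) (i j : Fin 3) :
    |(A * B) i j| ≤ 3 * (a * b) := by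
  rw [Matrix.mul_apply]
  refine (Finset.abs_sum_le_sum_abs _ _).trans ?_
  refine (Finset.sum_le_card_nsmul _ _ (a * b) fun k _ => ?_).trans (by simp)
  rw [abs_mul]
  exact mul_le_mul (hA _ _) (hB _ _) (abs_nonneg _) ha

lemma unit3.abs_le {n : Fin 3 → ℝ} (hn : unit3 n) (i : Fin 3) : |n i| ≤ 1 := by
  rw [← sq_le_one_iff_abs_le_one, ← show ∑ i, n i ^ 2 = 1 from hn]
  exact Finset.single_le_sum (f := fun i => n i ^ 2) (fun j _ => sq_nonneg _) (Finset.mem_univ i)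

lemma abs_outer3_le {n : Fin 3 → ℝ} (hn : unit3 n) (i j : Fin 3) : |outer3 n n i j| ≤ 1 := by
  simp only [outer3, Matrix.of_apply, abs_mul]
  exact mul_le_one₀ (hn.abs_le i) (abs_nonneg _) (hn.abs_le j)

lemma abs_ell_inv_le {r : ℝ} (hr : 0 < r) {n : Fin 3 → ℝ} (hn : unit3 n) (i j : Fin 3) :
    |(ell r n)⁻¹ i j| ≤ r ^ (1/3 : ℝ) * (1 + |1 - 1 / r|) := by
  rw [ell_inv hr hn]
  simp only [Matrix.smul_apply, Matrix.sub_apply, smul_eq_mul, abs_mul]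
  rw [abs_of_nonneg (by positivity : (0:ℝ) ≤ r ^ (1/3 : ℝ))]
  gcongr
  refine (abs_sub _ _).trans (add_le_add ?_ ?_)
  · rw [Matrix.one_apply]; split_ifs <;> simp
  · rw [abs_mul]
    exact mul_le_of_le_one_right (abs_nonneg _) (abs_outer3_le hn i j)

lemma abs_ell_sub_le {r : ℝ} (hr : 0 < r) {n m : Fin 3 → ℝ} (hn : unit3 n) (hm : unit3 m) {d : ℝ}
    (hd : ∀ i, |n i - m i| ≤ d) (i j : Fin 3) :
    |(ell r n - ell r m) i j| ≤ r ^ (-(1/3) : ℝ) * |r - 1| * (2 * d) := by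
  have : (ell r n - ell r m) i j = r ^ (-(1/3) : ℝ) * (r - 1) *
      (n i * (n j - m j) + (n i - m i) * m j) := by
    simp [ell, outer3]; ring
  rw [this, abs_mul, abs_mul, abs_of_nonneg (by positivity : (0:ℝ) ≤ r ^ (-(1/3) : ℝ))]
  gcongr
  refine (abs_add_le _ _).trans ?_
  rw [abs_mul, abs_mul]
  have hd0 : 0 ≤ d := (abs_nonneg _).trans (hd i)
  nlinarith [mul_le_mul (hn.abs_le i) (hd j) (abs_nonneg _) zero_le_one,
    mul_le_mul (hd i) (hm.abs_le j) (abs_nonneg _) hd0]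

lemma abs_transpose_mul_sub_le {F F0 : Matrix (Fin 3) (Fin 3) ℝ} {L d : ℝ} (hL : 0 ≤ L)
    (hd : 0 ≤ d) (hF0 : ∀ i j, |F0 i j| ≤ L) (hF : ∀ i j, |(F - F0) i j| ≤ d) (i j : Fin 3) :
    |(Fᵀ * F - F0ᵀ * F0) i j| ≤ 6 * L * d + 3 * d ^ 2 := by
  have : Fᵀ * F - F0ᵀ * F0 = F0ᵀ * (F - F0) + (F - F0)ᵀ * F0 + (F - F0)ᵀ * (F - F0) := by
    rw [Matrix.transpose_sub]; noncomm_ring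
  rw [this]
  have hF0' : ∀ i j, |F0ᵀ i j| ≤ L := fun i j => hF0 j i
  have hF' : ∀ i j, |(F - F0)ᵀ i j| ≤ d := fun i j => hF j i
  have h1 := abs_mul_apply_le hL hF0' hF i j
  have h2 := abs_mul_apply_le hd hF' hF0 i j
  have h3 := abs_mul_apply_le hd hF' hF i j
  simp only [Matrix.add_apply]
  refine (abs_add_three _ _ _).trans ?_
  nlinarith

/-- Quadratic growth of the energy near its zero set. -/
lemma We_quadratic {μ rf r0 : ℝ} (hμ : 0 < μ) (hrf : 1 ≤ rf) (hr0 : 1 ≤ r0) {L c τ : ℝ}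
    (hL : 0 ≤ L) (hc : 0 ≤ c) (hτ : 0 ≤ τ) :
    ∃ K : ℝ, 0 ≤ K ∧ ∀ (h : ℝ), 0 < h → h ≤ 1 → ∀ (F F0 : Matrix (Fin 3) (Fin 3) ℝ)
      (n n0 : Fin 3 → ℝ), unit3 n → unit3 n0 → F.det = 1 → F0ᵀ * F0 = ell (rf / r0) n0 →
      (∀ i j, |F0 i j| ≤ L) → (∀ i j, |(F - F0) i j| ≤ c * h) → (∀ i, |n i - n0 i| ≤ τ * h) →
      We μ rf r0 F (nvec (F *ᵥ n)) n ≤ K * h ^ 2 := by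
  set r := rf / r0
  have hr : 0 < r := by have : 0 < rf := by linarith
                        have : 0 < r0 := by linarith
                        positivity
  set k := 3 * ((r ^ (1/3 : ℝ) * (1 + |1 - 1 / r|)) *
    (6 * L * c + 3 * c ^ 2 + r ^ (-(1/3) : ℝ) * |r - 1| * (2 * τ))) with hk
  have hk0 : 0 ≤ k := by positivity
  refine ⟨μ / 2 * (6 * k ^ 2 + 6 * k ^ 3), by positivity, ?_⟩
  intro h hh hh1 F F0 n n0 hn hn0 hdet hmet hF0 hFd hnd
  refine (We_le hμ hrf hr0 hdet hn).trans ?_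
  rw [mul_assoc]
  refine mul_le_mul_of_nonneg_left ?_ (by positivity)
  set M := (ell r n)⁻¹ * (Fᵀ * F - ell r n) with hMdef
  have hinv : (ell r n)⁻¹ * ell r n = 1 := by rw [ell_inv hr hn]; exact ell_inv_mul hr hn
  have hM1 : (ell r n)⁻¹ * (Fᵀ * F) = 1 + M := by
    rw [hMdef, mul_sub, hinv]; abel
  have hM : ∀ i j, |M i j| ≤ k * h := by
    have hE : ∀ i j, |(Fᵀ * F - ell r n) i j| ≤
        (6 * L * c + 3 * c ^ 2 + r ^ (-(1/3) : ℝ) * |r - 1| * (2 * τ)) * h := by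
      intro i j
      have h1 := abs_transpose_mul_sub_le hL (by positivity) hF0 hFd i j
      have h2 := abs_ell_sub_le hr hn hn0 hnd i j
      have h3 : (Fᵀ * F - ell r n) i j =
          (Fᵀ * F - F0ᵀ * F0) i j - (ell r n - ell r n0) i j := by
        rw [hmet]; simp
      rw [h3]
      refine (abs_sub _ _).trans ?_
      have h4 : c ^ 2 * h ^ 2 ≤ c ^ 2 * h := by
        refine mul_le_mul_of_nonneg_left ?_ (by positivity)
        nlinarith
      nlinarith
    intro i j
    refine (abs_mul_apply_le (by positivity) (abs_ell_inv_le hr hn) hE i j).trans (le_of_eq ?_)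
    rw [hk]; ring
  have hd1 : (1 + M).det = 1 := by
    rw [← hM1, Matrix.det_mul, Matrix.det_mul, Matrix.det_transpose, hdet]
    have := congrArg Matrix.det hinv
    rw [Matrix.det_mul, det_ell hr hn, Matrix.det_one] at this
    linarith
  have ht := trace_le_of_det_one_add (by positivity) hM hd1
  rw [hM1, Matrix.trace_add, Matrix.trace_one, Fintype.card_fin]
  have h5 : h ^ 3 ≤ h ^ 2 := pow_le_pow_of_le_one hh.le hh1 (by norm_num)
  have h6 : k ^ 3 * h ^ 3 ≤ k ^ 3 * h ^ 2 := by gcongr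
  push_cast
  nlinarith

/-- A `C¹` branch, near `(u, v) = (0, 0)`, of the root of `σ + u σ² / 2 + v σ³ / 3 = 1` that equals
`1` at the origin. -/
lemma exists_cubic_root : ∃ ε : ℝ, 0 < ε ∧ ∃ S : ℝ × ℝ → ℝ, ContDiffOn ℝ 1 S (Metric.ball 0 ε) ∧
    ∀ w ∈ Metric.ball (0 : ℝ × ℝ) ε, S w + w.1 * S w ^ 2 / 2 + w.2 * S w ^ 3 / 3 = 1 ∧
      |S w| ≤ 2 ∧ 1 / 2 ≤ 1 + w.1 * S w + w.2 * S w ^ 2 := by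
  let f : (ℝ × ℝ) × ℝ → ℝ := fun z => z.2 + z.1.1 * z.2 ^ 2 / 2 + z.1.2 * z.2 ^ 3 / 3
  have hf : ContDiff ℝ 1 f := by fun_prop
  have hcd : ContDiffAt ℝ 1 f ((0, 0), 1) := hf.contDiffAt
  have hinr : fderiv ℝ f ((0, 0), 1) ∘L .inr ℝ (ℝ × ℝ) ℝ = ContinuousLinearMap.id ℝ ℝ := by
    have h1 : HasFDerivAt (fun t : ℝ => f ((0, 0), t))
        (fderiv ℝ f ((0, 0), 1) ∘L .inr ℝ (ℝ × ℝ) ℝ) 1 := by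
      have h2 : HasFDerivAt (fun t : ℝ => (((0, 0), t) : (ℝ × ℝ) × ℝ))
          (ContinuousLinearMap.inr ℝ (ℝ × ℝ) ℝ) 1 := hasFDerivAt_prodMk_right _ _
      exact (hcd.differentiableAt one_ne_zero).hasFDerivAt.comp 1 h2
    have h3 : (fun t : ℝ => f ((0, 0), t)) = id := by ext t; simp [f]
    rw [h3] at h1
    exact h1.unique (hasFDerivAt_id _)
  have hinv : (fderiv ℝ f ((0, 0), 1) ∘L .inr ℝ (ℝ × ℝ) ℝ).IsInvertible := by
    rw [hinr]; exact ⟨ContinuousLinearEquiv.refl ℝ ℝ, rfl⟩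
  let S := hcd.implicitFunction one_ne_zero hinv
  have hS0 : S (0, 0) = 1 := hcd.implicitFunction_apply_self one_ne_zero hinv
  have hSd : ContDiffAt ℝ 1 S (0, 0) := hcd.contDiffAt_implicitFunction one_ne_zero hinv
  have hSe : ∀ᶠ w in nhds ((0, 0) : ℝ × ℝ), f (w, S w) = f ((0, 0), 1) :=
    hcd.eventually_apply_implicitFunction one_ne_zero hinv
  have hSc := hSd.continuousAt
  have e1 : ∀ᶠ w in nhds ((0, 0) : ℝ × ℝ), |S w| < 2 :=
    hSc.abs.eventually_lt continuousAt_const (by simp [hS0])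
  have e2 : ∀ᶠ w in nhds ((0, 0) : ℝ × ℝ), 1 / 2 < 1 + w.1 * S w + w.2 * S w ^ 2 := by
    refine ContinuousAt.eventually_lt continuousAt_const ?_ (by norm_num)
    fun_prop
  obtain ⟨ε, hε, hball⟩ := Metric.eventually_nhds_iff_ball.1
    ((hSd.eventually (by simp)).and (hSe.and (e1.and e2)))
  refine ⟨ε, hε, S, fun w hw => (hball w hw).1.contDiffWithinAt, fun w hw => ?_⟩
  obtain ⟨-, h1, h2, h3⟩ := hball w hw
  exact ⟨by simpa [f] using h1, h2.le, h3.le⟩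

/-- The matrix with columns `u`, `v`, `w`. -/
def frame3 (u v w : Fin 3 → ℝ) : Matrix (Fin 3) (Fin 3) ℝ := Matrix.of fun i => ![u i, v i, w i]

lemma det_frame3 (u v w : Fin 3 → ℝ) : (frame3 u v w).det =
    u 0 * v 1 * w 2 - u 0 * w 1 * v 2 - v 0 * u 1 * w 2 + v 0 * w 1 * u 2
      + w 0 * u 1 * v 2 - w 0 * v 1 * u 2 := by
  rw [Matrix.det_fin_three]; simp [frame3]

lemma ContDiffOn.det_frame3 {E : Type*} [NormedAddCommGroup E] [NormedSpace ℝ E] {s : Set E}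
    {m : WithTop ℕ∞} {u v w : E → Fin 3 → ℝ} (hu : ContDiffOn ℝ m u s) (hv : ContDiffOn ℝ m v s)
    (hw : ContDiffOn ℝ m w s) : ContDiffOn ℝ m (fun x => (frame3 (u x) (v x) (w x)).det) s := by
  simp only [_root_.det_frame3]
  rw [contDiffOn_pi] at hu hv hw
  have hu0 := hu 0
  have hu1 := hu 1
  have hu2 := hu 2
  have hv0 := hv 0
  have hv1 := hv 1
  have hv2 := hv 2
  have hw0 := hw 0
  have hw1 := hw 1
  have hw2 := hw 2
  fun_prop

/-- The planar partial derivative `∂ⱼ f`. -/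
def partial2 (f : (Fin 2 → ℝ) → Fin 3 → ℝ) (j : Fin 2) (x : Fin 2 → ℝ) : Fin 3 → ℝ :=
  fderiv ℝ f x (Pi.single j 1)

lemma ContDiffOn.partial2 {f : (Fin 2 → ℝ) → Fin 3 → ℝ} {s : Set (Fin 2 → ℝ)} (hs : IsOpen s)
    {m k : WithTop ℕ∞} (hf : ContDiffOn ℝ k f s) (hmk : m + 1 ≤ k) (j : Fin 2) :
    ContDiffOn ℝ m (partial2 f j) s :=
  (hf.fderiv_of_isOpen hs hmk).clm_apply contDiffOn_const

/-- The projection `x ↦ (x₁, x₂)` as a continuous linear map. -/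
def proj2L : (Fin 3 → ℝ) →L[ℝ] (Fin 2 → ℝ) :=
  ContinuousLinearMap.pi fun j => ContinuousLinearMap.proj j.castSucc

lemma proj2L_apply (x : Fin 3 → ℝ) : proj2L x = proj2 x := rfl

lemma proj2_single_castSucc (j : Fin 2) :
    proj2 (Pi.single j.castSucc 1) = (Pi.single j 1 : Fin 2 → ℝ) := by
  ext k; fin_cases j <;> fin_cases k <;> simp [proj2]

lemma proj2_single_two : proj2 (Pi.single 2 1) = 0 := by
  ext k; fin_cases k <;> simp [proj2]

lemma continuous_proj2 : Continuous proj2 := proj2L.continuous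

/-- Implicit differentiation of `φ + p φ² / 2 + q φ³ / 3 = x₃`. -/
lemma implicit_fderiv {p q : (Fin 2 → ℝ) → ℝ} {φ : (Fin 3 → ℝ) → ℝ} {x : Fin 3 → ℝ}
    {p' q' : (Fin 2 → ℝ) →L[ℝ] ℝ} {φ' : (Fin 3 → ℝ) →L[ℝ] ℝ}
    (hp : HasFDerivAt p p' (proj2 x)) (hq : HasFDerivAt q q' (proj2 x)) (hφ : HasFDerivAt φ φ' x)
    (h : ∀ᶠ z in nhds x, φ z + p (proj2 z) * φ z ^ 2 / 2 + q (proj2 z) * φ z ^ 3 / 3 = z 2)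
    (v : Fin 3 → ℝ) :
    (1 + p (proj2 x) * φ x + q (proj2 x) * φ x ^ 2) * φ' v
      + φ x ^ 2 / 2 * p' (proj2 v) + φ x ^ 3 / 3 * q' (proj2 v) = v 2 := by
  have hπ : HasFDerivAt proj2 proj2L x := proj2L.hasFDerivAt
  have hp' : HasFDerivAt (fun z => p (proj2 z)) (p' ∘L proj2L) x := hp.comp x hπ
  have hq' : HasFDerivAt (fun z => q (proj2 z)) (q' ∘L proj2L) x := hq.comp x hπ
  have h1 := (hφ.add ((hp'.mul (hφ.pow 2)).mul_const (1 / 2 : ℝ))).add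
    ((hq'.mul (hφ.pow 3)).mul_const (1 / 3 : ℝ))
  have h2 : HasFDerivAt (fun z : Fin 3 → ℝ => z 2)
      (ContinuousLinearMap.proj (R := ℝ) (φ := fun _ : Fin 3 => ℝ) 2) x :=
    (ContinuousLinearMap.proj (R := ℝ) (φ := fun _ : Fin 3 => ℝ) 2).hasFDerivAt
  have h3 := h1.unique (h2.congr_of_eventuallyEq (by
    filter_upwards [h] with z hz
    rw [← hz]
    simp
    ring))
  have h4 := DFunLike.congr_fun h3 v
  simp [proj2L_apply] at h4
  rw [← h4]
  ring

lemma jac3_add_smul {y b : (Fin 2 → ℝ) → Fin 3 → ℝ} {φ : (Fin 3 → ℝ) → ℝ} {x : Fin 3 → ℝ}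
    (hy : DifferentiableAt ℝ y (proj2 x)) (hb : DifferentiableAt ℝ b (proj2 x))
    {φ' : (Fin 3 → ℝ) →L[ℝ] ℝ} (hφ : HasFDerivAt φ φ' x) :
    jac3 (fun z => y (proj2 z) + φ z • b (proj2 z)) x = frame3
      (partial2 y 0 (proj2 x) + φ x • partial2 b 0 (proj2 x) + φ' (Pi.single 0 1) • b (proj2 x))
      (partial2 y 1 (proj2 x) + φ x • partial2 b 1 (proj2 x) + φ' (Pi.single 1 1) • b (proj2 x))
      (φ' (Pi.single 2 1) • b (proj2 x)) := by
  have hπ : HasFDerivAt proj2 proj2L x := proj2L.hasFDerivAt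
  have hy' : HasFDerivAt (fun z => y (proj2 z)) (fderiv ℝ y (proj2 x) ∘L proj2L) x :=
    hy.hasFDerivAt.comp x hπ
  have hb' : HasFDerivAt (fun z => b (proj2 z)) (fderiv ℝ b (proj2 x) ∘L proj2L) x :=
    hb.hasFDerivAt.comp x hπ
  have h1 := (hy'.add (hφ.smul hb')).fderiv
  have e0 : proj2 (Pi.single 0 1) = (Pi.single 0 1 : Fin 2 → ℝ) := proj2_single_castSucc 0
  have e1 : proj2 (Pi.single 1 1) = (Pi.single 1 1 : Fin 2 → ℝ) := proj2_single_castSucc 1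
  have h2 : ∀ v, fderiv ℝ (fun z => y (proj2 z) + φ z • b (proj2 z)) x v =
      fderiv ℝ y (proj2 x) (proj2 v) + φ x • fderiv ℝ b (proj2 x) (proj2 v)
        + φ' v • b (proj2 x) := by
    intro v
    refine (DFunLike.congr_fun h1 v).trans ?_
    simp [proj2L_apply, add_assoc]
  ext i j
  simp only [jac3, Matrix.of_apply, h2]
  fin_cases j
  · simp [frame3, partial2, e0]
  · simp [frame3, partial2, e1]
  · simp [frame3, proj2_single_two]

lemma det_frame3_shift (a₁ a₂ b b₁ b₂ : Fin 3 → ℝ) (s k₁ k₂ t : ℝ) :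
    (frame3 (a₁ + s • b₁ + k₁ • b) (a₂ + s • b₂ + k₂ • b) (t • b)).det =
      t * ((frame3 a₁ a₂ b).det + ((frame3 b₁ a₂ b).det + (frame3 a₁ b₂ b).det) * s
        + (frame3 b₁ b₂ b).det * s ^ 2) := by
  simp only [det_frame3, Pi.add_apply, Pi.smul_apply, smul_eq_mul]; ring

/-- Incompressible extension of a surface along a unimodular transversal `b`. -/
lemma exists_incompressible_extension {V K : Set (Fin 2 → ℝ)} (hV : IsOpen V) (hK : IsCompact K)
    (hKV : K ⊆ V) {y b : (Fin 2 → ℝ) → Fin 3 → ℝ} (hy : ContDiffOn ℝ 2 y V)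
    (hb : ContDiffOn ℝ 2 b V)
    (hdet : ∀ x ∈ V, (frame3 (partial2 y 0 x) (partial2 y 1 x) (b x)).det = 1) :
    ∃ (Y : (Fin 3 → ℝ) → Fin 3 → ℝ) (U : Set (Fin 3 → ℝ)) (h₀ c : ℝ), IsOpen U ∧ 0 < h₀ ∧ 0 ≤ c ∧
      ContDiffOn ℝ 1 Y U ∧ (∀ xt, Y (emb xt 0) = y xt) ∧
      ∀ h, 0 < h → h < h₀ → ∀ x, proj2 x ∈ K → |x 2| ≤ h / 2 → x ∈ U ∧ (jac3 Y x).det = 1 ∧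
        ∀ i j, |(jac3 Y x -
          frame3 (partial2 y 0 (proj2 x)) (partial2 y 1 (proj2 x)) (b (proj2 x))) i j| ≤ c * h := by
  obtain ⟨ε, hε, S, hS, hSball⟩ := exists_cubic_root
  have hone : (1 : WithTop ℕ∞) + 1 ≤ 2 := by norm_num
  have ha1 := hy.partial2 hV hone
  have hb1 := hb.partial2 hV hone
  have hb0 : ContDiffOn ℝ 1 b V := hb.of_le (by norm_num)
  let p : (Fin 2 → ℝ) → ℝ := fun x => (frame3 (partial2 b 0 x) (partial2 y 1 x) (b x)).det
    + (frame3 (partial2 y 0 x) (partial2 b 1 x) (b x)).det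
  let q : (Fin 2 → ℝ) → ℝ := fun x => (frame3 (partial2 b 0 x) (partial2 b 1 x) (b x)).det
  have hp : ContDiffOn ℝ 1 p V :=
    ((hb1 0).det_frame3 (ha1 1) hb0).add ((ha1 0).det_frame3 (hb1 1) hb0)
  have hq : ContDiffOn ℝ 1 q V := (hb1 0).det_frame3 (hb1 1) hb0
  let W : (Fin 3 → ℝ) → ℝ × ℝ := fun x => (p (proj2 x) * x 2, q (proj2 x) * x 2 ^ 2)
  let φ : (Fin 3 → ℝ) → ℝ := fun x => x 2 * S (W x)
  have hπ : ContDiff ℝ 1 proj2 := proj2L.contDiff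
  have hmaps : Set.MapsTo proj2 (proj2 ⁻¹' V) V := fun _ h => h
  have hcoord : ContDiffOn ℝ 1 (fun x : Fin 3 → ℝ => x 2) (proj2 ⁻¹' V) := by fun_prop
  have hW : ContDiffOn ℝ 1 W (proj2 ⁻¹' V) :=
    ((hp.comp hπ.contDiffOn hmaps).mul hcoord).prodMk
      ((hq.comp hπ.contDiffOn hmaps).mul (hcoord.pow 2))
  let U := proj2 ⁻¹' V ∩ W ⁻¹' Metric.ball 0 ε
  have hU : IsOpen U :=
    hW.continuousOn.isOpen_inter_preimage (hV.preimage continuous_proj2) Metric.isOpen_ball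
  have hφ : ContDiffOn ℝ 1 φ U := (hcoord.mono Set.inter_subset_left).mul
    (hS.comp (hW.mono Set.inter_subset_left) fun _ h => h.2)
  have hφeq : ∀ z ∈ U,
      φ z + p (proj2 z) * φ z ^ 2 / 2 + q (proj2 z) * φ z ^ 3 / 3 = z 2 := by
    intro z hz
    have h1 := (hSball _ hz.2).1
    have : φ z + p (proj2 z) * φ z ^ 2 / 2 + q (proj2 z) * φ z ^ 3 / 3 =
        z 2 * (S (W z) + (W z).1 * S (W z) ^ 2 / 2 + (W z).2 * S (W z) ^ 3 / 3) := by
      simp only [φ, W]; ring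
    rw [this, h1, mul_one]
  let Y : (Fin 3 → ℝ) → Fin 3 → ℝ := fun z => y (proj2 z) + φ z • b (proj2 z)
  have hY : ContDiffOn ℝ 1 Y U :=
    (((hy.of_le (by norm_num)).comp hπ.contDiffOn hmaps).mono Set.inter_subset_left).add
      (hφ.smul ((hb0.comp hπ.contDiffOn hmaps).mono Set.inter_subset_left))
  have hbound : ∀ {E : Type} [NormedAddCommGroup E] (f : (Fin 2 → ℝ) → E), ContinuousOn f V →
      ∃ C, ∀ x ∈ K, ‖f x‖ ≤ C :=
    fun f hf => hK.exists_bound_of_continuousOn (hf.mono hKV)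
  obtain ⟨L1, hL1⟩ := hbound b hb0.continuousOn
  obtain ⟨L2, hL2⟩ := hbound _ (hb1 0).continuousOn
  obtain ⟨L3, hL3⟩ := hbound _ (hb1 1).continuousOn
  obtain ⟨L4, hL4⟩ := hbound p hp.continuousOn
  obtain ⟨L5, hL5⟩ := hbound q hq.continuousOn
  obtain ⟨L6, hL6⟩ := hbound _ (hp.continuousOn_fderiv_of_isOpen hV le_rfl)
  obtain ⟨L7, hL7⟩ := hbound _ (hq.continuousOn_fderiv_of_isOpen hV le_rfl)
  obtain ⟨L, hL0, hLb, hLb0, hLb1, hLp, hLq, hLp', hLq'⟩ : ∃ L : ℝ, 0 < L ∧ (∀ x ∈ K, ‖b x‖ ≤ L) ∧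
      (∀ x ∈ K, ‖partial2 b 0 x‖ ≤ L) ∧ (∀ x ∈ K, ‖partial2 b 1 x‖ ≤ L) ∧ (∀ x ∈ K, ‖p x‖ ≤ L) ∧
      (∀ x ∈ K, ‖q x‖ ≤ L) ∧ (∀ x ∈ K, ‖fderiv ℝ p x‖ ≤ L) ∧ (∀ x ∈ K, ‖fderiv ℝ q x‖ ≤ L) := by
    refine ⟨1 + |L1| + |L2| + |L3| + |L4| + |L5| + |L6| + |L7|, by positivity, ?_⟩
    have := abs_nonneg L1
    have := abs_nonneg L2
    have := abs_nonneg L3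
    have := abs_nonneg L4
    have := abs_nonneg L5
    have := abs_nonneg L6
    have := abs_nonneg L7
    refine ⟨fun x hx => (hL1 x hx).trans ?_, fun x hx => (hL2 x hx).trans ?_,
      fun x hx => (hL3 x hx).trans ?_, fun x hx => (hL4 x hx).trans ?_,
      fun x hx => (hL5 x hx).trans ?_, fun x hx => (hL6 x hx).trans ?_,
      fun x hx => (hL7 x hx).trans ?_⟩
    · linarith [le_abs_self L1]
    · linarith [le_abs_self L2]
    · linarith [le_abs_self L3]
    · linarith [le_abs_self L4]
    · linarith [le_abs_self L5]
    · linarith [le_abs_self L6]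
    · linarith [le_abs_self L7]
  refine ⟨Y, U, min 1 (ε / L), L + 4 * L ^ 2, hU, lt_min one_pos (by positivity), by positivity,
    hY, ?_, ?_⟩
  · intro xt
    have e1 : proj2 (emb xt 0) = xt := by
      ext k; fin_cases k <;> simp [proj2, emb]
    have e2 : emb xt 0 2 = 0 := by simp [emb]
    simp [Y, φ, e1, e2]
  intro h hh hh0 x hx hx2
  have hh1 : h < 1 := hh0.trans_le (min_le_left _ _)
  have hhε : L * h < ε := by
    have := hh0.trans_le (min_le_right _ _)
    rw [lt_div_iff₀ hL0] at this; linarith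
  have hxV : proj2 x ∈ V := hKV hx
  have hx1 : |x 2| ≤ h := by linarith
  have hxU : x ∈ U := by
    refine ⟨hxV, ?_⟩
    rw [Set.mem_preimage, mem_ball_zero_iff, Prod.norm_def, max_lt_iff]
    simp only [W, norm_mul, norm_pow]
    have h1 : ‖x 2‖ ≤ h := hx1
    have h2 : ‖x 2‖ ^ 2 ≤ h := by nlinarith [norm_nonneg (x 2)]
    exact ⟨(mul_le_mul (hLp _ hx) h1 (norm_nonneg _) hL0.le).trans_lt hhε,
      (mul_le_mul (hLq _ hx) h2 (by positivity) hL0.le).trans_lt hhε⟩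
  refine ⟨hxU, ?_⟩
  have hUx : U ∈ nhds x := hU.mem_nhds hxU
  have hVx : V ∈ nhds (proj2 x) := hV.mem_nhds hxV
  have hφ' : HasFDerivAt φ (fderiv ℝ φ x) x :=
    ((hφ.contDiffAt hUx).differentiableAt one_ne_zero).hasFDerivAt
  have hp' : HasFDerivAt p (fderiv ℝ p (proj2 x)) (proj2 x) :=
    ((hp.contDiffAt hVx).differentiableAt one_ne_zero).hasFDerivAt
  have hq' : HasFDerivAt q (fderiv ℝ q (proj2 x)) (proj2 x) :=
    ((hq.contDiffAt hVx).differentiableAt one_ne_zero).hasFDerivAt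
  have himp := implicit_fderiv hp' hq' hφ' (by filter_upwards [hUx] with z hz using hφeq z hz)
  have hJ : jac3 Y x = _ := jac3_add_smul ((hy.contDiffAt hVx).differentiableAt two_ne_zero)
    ((hb.contDiffAt hVx).differentiableAt two_ne_zero) hφ'
  set P := 1 + p (proj2 x) * φ x + q (proj2 x) * φ x ^ 2 with hP
  have hPhalf : 1 / 2 ≤ P := by
    have h1 := (hSball _ hxU.2).2.2
    have : P = 1 + (W x).1 * S (W x) + (W x).2 * S (W x) ^ 2 := by
      simp only [hP, φ, W]; ring
    rwa [this]
  have hφh : |φ x| ≤ h := by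
    have h1 := (hSball _ hxU.2).2.1
    simp only [φ, abs_mul]
    have := mul_le_mul hx2 h1 (abs_nonneg _) (by linarith)
    linarith
  have hφ2 : |φ x ^ 2| ≤ h := by rw [abs_pow]; nlinarith [abs_nonneg (φ x)]
  have hφ3 : |φ x ^ 3| ≤ h := by
    rw [pow_succ, abs_mul]
    nlinarith [abs_nonneg (φ x), abs_nonneg (φ x ^ 2)]
  have hdiv : ∀ a c : ℝ, |P * a| ≤ c → |a| ≤ 2 * c := by
    intro a c hac
    rw [abs_mul, abs_of_pos (by linarith : 0 < P)] at hac
    nlinarith [abs_nonneg a]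
  have h3 : P * fderiv ℝ φ x (Pi.single 2 1) = 1 := by
    have := himp (Pi.single 2 1)
    simpa [proj2_single_two] using this
  have hunit : ∀ (f : (Fin 2 → ℝ) →L[ℝ] ℝ) (j : Fin 2), ‖f‖ ≤ L → |f (Pi.single j 1)| ≤ L := by
    intro f j hf
    refine (f.le_opNorm (Pi.single j 1)).trans ?_
    rw [Pi.norm_single, norm_one, mul_one]; exact hf
  have hα : ∀ j : Fin 2, |fderiv ℝ φ x (Pi.single j.castSucc 1)| ≤ 2 * (L * h) := by
    intro j
    have h1 := himp (Pi.single j.castSucc 1)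
    rw [proj2_single_castSucc, Pi.single_eq_of_ne (by fin_cases j <;> simp)] at h1
    refine hdiv _ _ ?_
    have h2 : P * fderiv ℝ φ x (Pi.single j.castSucc 1) =
        -(φ x ^ 2 * fderiv ℝ p (proj2 x) (Pi.single j 1) / 2
          + φ x ^ 3 * fderiv ℝ q (proj2 x) (Pi.single j 1) / 3) := by linarith
    have h4 := mul_le_mul hφ2 (hunit _ j (hLp' _ hx)) (abs_nonneg _) hh.le
    have h5 := mul_le_mul hφ3 (hunit _ j (hLq' _ hx)) (abs_nonneg _) hh.le
    rw [← abs_mul] at h4 h5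
    have := mul_pos hL0 hh
    rw [h2, abs_neg]
    rw [abs_le] at h4 h5 ⊢
    constructor <;> linarith
  have ht : |fderiv ℝ φ x (Pi.single 2 1) - 1| ≤ 2 * (2 * (L * h)) := by
    refine hdiv _ _ ?_
    rw [mul_sub, h3, hP]
    have h4 := mul_le_mul (hLp _ hx) hφh (abs_nonneg _) hL0.le
    have h5 := mul_le_mul (hLq _ hx) hφ2 (abs_nonneg _) hL0.le
    rw [Real.norm_eq_abs, ← abs_mul] at h4 h5
    rw [abs_le] at h4 h5 ⊢
    constructor <;> linarith
  have hcomp : ∀ (f : Fin 3 → ℝ) (i : Fin 3), ‖f‖ ≤ L → |f i| ≤ L :=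
    fun f i hf => (norm_le_pi_norm f i).trans hf
  constructor
  · rw [hJ, det_frame3_shift, hdet _ hxV, mul_comm]
    exact h3
  · have hcol : ∀ s k u v : ℝ, |s| ≤ h → |k| ≤ 2 * (L * h) → |u| ≤ L → |v| ≤ L →
        |s * u + k * v| ≤ (L + 4 * L ^ 2) * h := by
      intro s k u v hs hk hu hv
      refine (abs_add_le _ _).trans ?_
      rw [abs_mul, abs_mul]
      have h4 := mul_le_mul hs hu (abs_nonneg _) hh.le
      have h5 := mul_le_mul hk hv (abs_nonneg _) (by positivity)
      nlinarith [mul_pos (mul_pos hL0 hL0) hh]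
    intro i j
    rw [hJ, Matrix.sub_apply]
    fin_cases j
    · have := hcol _ _ _ _ hφh (hα 0) (hcomp _ i (hLb0 _ hx)) (hcomp _ i (hLb _ hx))
      refine le_trans (le_of_eq ?_) this
      simp [frame3, add_assoc]
    · have := hcol _ _ _ _ hφh (hα 1) (hcomp _ i (hLb1 _ hx)) (hcomp _ i (hLb _ hx))
      refine le_trans (le_of_eq ?_) this
      simp [frame3, add_assoc]
    · have h4 := mul_le_mul ht (hcomp _ i (hLb _ hx)) (abs_nonneg _) (by positivity)
      rw [← abs_mul] at h4
      refine le_trans (le_of_eq ?_) (h4.trans ?_)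
      · rw [sub_mul, one_mul]; simp [frame3]
      · nlinarith [mul_pos hL0 hh]

lemma transpose_frame3_mul (u v w : Fin 3 → ℝ) : (frame3 u v w)ᵀ * frame3 u v w =
    Matrix.of ![![u ⬝ᵥ u, u ⬝ᵥ v, u ⬝ᵥ w], ![v ⬝ᵥ u, v ⬝ᵥ v, v ⬝ᵥ w], ![w ⬝ᵥ u, w ⬝ᵥ v, w ⬝ᵥ w]] := by
  ext i j
  fin_cases i <;> fin_cases j <;> simp [frame3, Matrix.mul_apply, dotProduct]

/-- The Gram determinant of two vectors. -/
def gramDet (u v : Fin 3 → ℝ) : ℝ := (u ⬝ᵥ u) * (v ⬝ᵥ v) - (u ⬝ᵥ v) ^ 2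

/-- The vector with prescribed inner products `c₁`, `c₂` with `u` and `v` whose component along
`u × v` makes `(u | v | transversal)` unimodular. -/
def transversal (u v : Fin 3 → ℝ) (c₁ c₂ : ℝ) : Fin 3 → ℝ :=
  (gramDet u v)⁻¹ • (((v ⬝ᵥ v) * c₁ - (u ⬝ᵥ v) * c₂) • u + ((u ⬝ᵥ u) * c₂ - (u ⬝ᵥ v) * c₁) • v
    + ![u 1 * v 2 - u 2 * v 1, u 2 * v 0 - u 0 * v 2, u 0 * v 1 - u 1 * v 0])

lemma det_frame3_transversal {u v : Fin 3 → ℝ} (h : gramDet u v ≠ 0) (c₁ c₂ : ℝ) :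
    (frame3 u v (transversal u v c₁ c₂)).det = 1 := by
  have h1 := inv_mul_cancel₀ h
  rw [det_frame3]
  unfold transversal
  set δ := (gramDet u v)⁻¹
  simp only [gramDet, dotProduct, Fin.sum_univ_three, Pi.smul_apply, Pi.add_apply, smul_eq_mul] at h1 ⊢
  simp
  linear_combination h1

lemma dotProduct_transversal_left {u v : Fin 3 → ℝ} (h : gramDet u v ≠ 0) (c₁ c₂ : ℝ) :
    u ⬝ᵥ transversal u v c₁ c₂ = c₁ := by
  have h1 := inv_mul_cancel₀ h
  unfold transversal
  set δ := (gramDet u v)⁻¹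
  simp only [gramDet, dotProduct, Fin.sum_univ_three, Pi.smul_apply, Pi.add_apply, smul_eq_mul] at h1 ⊢
  simp
  linear_combination c₁ * h1

lemma dotProduct_transversal_right {u v : Fin 3 → ℝ} (h : gramDet u v ≠ 0) (c₁ c₂ : ℝ) :
    v ⬝ᵥ transversal u v c₁ c₂ = c₂ := by
  have h1 := inv_mul_cancel₀ h
  unfold transversal
  set δ := (gramDet u v)⁻¹
  simp only [gramDet, dotProduct, Fin.sum_univ_three, Pi.smul_apply, Pi.add_apply, smul_eq_mul] at h1 ⊢
  simp
  linear_combination c₂ * h1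

lemma gramDet_mul_transversal_sq {u v : Fin 3 → ℝ} (h : gramDet u v ≠ 0) (c₁ c₂ : ℝ) :
    gramDet u v * (transversal u v c₁ c₂ ⬝ᵥ transversal u v c₁ c₂) =
      (v ⬝ᵥ v) * c₁ ^ 2 - 2 * (u ⬝ᵥ v) * c₁ * c₂ + (u ⬝ᵥ u) * c₂ ^ 2 + 1 := by
  have h1 := dotProduct_transversal_left h c₁ c₂
  have h2 := dotProduct_transversal_right h c₁ c₂
  have h3 := det_frame3_transversal h c₁ c₂
  set t := transversal u v c₁ c₂ with ht
  have key : gramDet u v • t = ((v ⬝ᵥ v) * c₁ - (u ⬝ᵥ v) * c₂) • u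
      + ((u ⬝ᵥ u) * c₂ - (u ⬝ᵥ v) * c₁) • v
      + ![u 1 * v 2 - u 2 * v 1, u 2 * v 0 - u 0 * v 2, u 0 * v 1 - u 1 * v 0] := by
    rw [ht, transversal, smul_smul, mul_inv_cancel₀ h, one_smul]
  rw [← smul_eq_mul, ← smul_dotProduct, key, add_dotProduct, add_dotProduct, smul_dotProduct,
    smul_dotProduct, h1, h2]
  have h4 : ![u 1 * v 2 - u 2 * v 1, u 2 * v 0 - u 0 * v 2, u 0 * v 1 - u 1 * v 0] ⬝ᵥ t = 1 := by
    rw [← h3, det_frame3]; simp [dotProduct, Fin.sum_univ_three]; ring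
  rw [h4]
  simp only [smul_eq_mul]
  ring

/-- If the Gram matrix of `u`, `v` is the planar step-length tensor, then the transversal completes
it to the full step-length tensor. -/
lemma transpose_frame3_mul_eq_ell {r : ℝ} (hr : 0 < r) {n u v : Fin 3 → ℝ} (hn : unit3 n)
    (h : gramDet u v ≠ 0)
    (huu : u ⬝ᵥ u = ellT r n 0 0) (huv : u ⬝ᵥ v = ellT r n 0 1) (hvv : v ⬝ᵥ v = ellT r n 1 1) :
    let t := transversal u v (ell r n 0 2) (ell r n 1 2)
    (frame3 u v t)ᵀ * frame3 u v t = ell r n := by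
  intro t
  have h1 : u ⬝ᵥ t = _ := dotProduct_transversal_left h (ell r n 0 2) (ell r n 1 2)
  have h2 : v ⬝ᵥ t = _ := dotProduct_transversal_right h (ell r n 0 2) (ell r n 1 2)
  have h3 : gramDet u v * (t ⬝ᵥ t) = _ :=
    gramDet_mul_transversal_sq h (ell r n 0 2) (ell r n 1 2)
  have hρ : (r ^ (-(1/3) : ℝ)) ^ 3 * r = 1 := by
    rw [← Real.rpow_natCast, ← Real.rpow_mul hr.le]; norm_num [Real.rpow_neg_one, hr.ne']
  have hn' : n 0 ^ 2 + n 1 ^ 2 + n 2 ^ 2 = 1 := by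
    have := hn; unfold unit3 at this; rwa [Fin.sum_univ_three] at this
  have h4 : t ⬝ᵥ t = ell r n 2 2 := by
    apply mul_left_cancel₀ h
    rw [h3, gramDet, huu, huv, hvv]
    simp only [ellT, ell, outer3, Matrix.smul_apply, Matrix.add_apply, Matrix.of_apply, smul_eq_mul]
    set ρ := r ^ (-(1/3) : ℝ)
    simp
    linear_combination (-1) * hρ - ρ ^ 3 * (r - 1) * hn'
  rw [transpose_frame3_mul, dotProduct_comm v u, dotProduct_comm t u, dotProduct_comm t v, h1, h2,
    h4, huu, huv, hvv]
  ext i j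
  fin_cases i <;> fin_cases j <;> simp [ell, ellT, outer3] <;>
    first | ring1 | (ring_nf; done) | (ring_nf; simp)

lemma ContDiffOn.dotProduct3 {E : Type*} [NormedAddCommGroup E] [NormedSpace ℝ E] {s : Set E}
    {m : WithTop ℕ∞} {u v : E → Fin 3 → ℝ} (hu : ContDiffOn ℝ m u s) (hv : ContDiffOn ℝ m v s) :
    ContDiffOn ℝ m (fun x => u x ⬝ᵥ v x) s := by
  rw [contDiffOn_pi] at hu hv
  exact ContDiffOn.sum fun i _ => (hu i).mul (hv i)

lemma ContDiffOn.gramDet {E : Type*} [NormedAddCommGroup E] [NormedSpace ℝ E] {s : Set E}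
    {m : WithTop ℕ∞} {u v : E → Fin 3 → ℝ} (hu : ContDiffOn ℝ m u s) (hv : ContDiffOn ℝ m v s) :
    ContDiffOn ℝ m (fun x => gramDet (u x) (v x)) s :=
  ((hu.dotProduct3 hu).mul (hv.dotProduct3 hv)).sub ((hu.dotProduct3 hv).pow 2)

lemma ContDiffOn.transversal {E : Type*} [NormedAddCommGroup E] [NormedSpace ℝ E] {s : Set E}
    {m : WithTop ℕ∞} {u v : E → Fin 3 → ℝ} {c₁ c₂ : E → ℝ} (hu : ContDiffOn ℝ m u s)
    (hv : ContDiffOn ℝ m v s) (hc₁ : ContDiffOn ℝ m c₁ s) (hc₂ : ContDiffOn ℝ m c₂ s)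
    (h : ∀ x ∈ s, _root_.gramDet (u x) (v x) ≠ 0) :
    ContDiffOn ℝ m (fun x => transversal (u x) (v x) (c₁ x) (c₂ x)) s := by
  refine ContDiffOn.smul ((hu.gramDet hv).inv h) (ContDiffOn.add (ContDiffOn.add ?_ ?_) ?_)
  · exact (((hv.dotProduct3 hv).mul hc₁).sub ((hu.dotProduct3 hv).mul hc₂)).smul hu
  · exact (((hu.dotProduct3 hu).mul hc₂).sub ((hu.dotProduct3 hv).mul hc₁)).smul hv
  · rw [contDiffOn_pi] at hu hv
    rw [contDiffOn_pi]
    intro i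
    fin_cases i
    · exact ((hu 1).mul (hv 2)).sub ((hu 2).mul (hv 1))
    · exact ((hu 2).mul (hv 0)).sub ((hu 0).mul (hv 2))
    · exact ((hu 0).mul (hv 1)).sub ((hu 1).mul (hv 0))

lemma gramDet_ge {r : ℝ} {n u v : Fin 3 → ℝ} (hn : unit3 n)
    (huu : u ⬝ᵥ u = ellT r n 0 0) (huv : u ⬝ᵥ v = ellT r n 0 1) (hvv : v ⬝ᵥ v = ellT r n 1 1) :
    (r ^ (-(1/3) : ℝ)) ^ 2 * min 1 r ≤ gramDet u v := by
  have hn' : n 0 ^ 2 + n 1 ^ 2 + n 2 ^ 2 = 1 := by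
    have := hn; unfold unit3 at this; rwa [Fin.sum_univ_three] at this
  have : gramDet u v = (r ^ (-(1/3) : ℝ)) ^ 2 * (n 2 ^ 2 * 1 + (n 0 ^ 2 + n 1 ^ 2) * r) := by
    rw [gramDet, huu, huv, hvv]
    simp only [ellT, Matrix.smul_apply, Matrix.add_apply, Matrix.of_apply, smul_eq_mul]
    set ρ := r ^ (-(1/3) : ℝ)
    simp
    linear_combination (-ρ ^ 2) * hn'
  rw [this]
  refine mul_le_mul_of_nonneg_left ?_ (by positivity)
  calc min 1 r = n 2 ^ 2 * min 1 r + (n 0 ^ 2 + n 1 ^ 2) * min 1 r := by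
        linear_combination (-min 1 r) * hn'
    _ ≤ _ := by
        gcongr
        · exact min_le_left _ _
        · exact min_le_right _ _

lemma gram_of_metric {r : ℝ} {n : Fin 3 → ℝ} {y : (Fin 2 → ℝ) → Fin 3 → ℝ} {x : Fin 2 → ℝ}
    (h : (jac32 y x)ᵀ * jac32 y x = ellT r n) (i j : Fin 2) :
    partial2 y i x ⬝ᵥ partial2 y j x = ellT r n i j := by
  rw [← h]; rfl

/-- The transversal field attached to an immersion with metric `ℓ̃`, near the closure of `ω`. -/
lemma exists_transversal_field {ω U₁ U₂ : Set (Fin 2 → ℝ)} {r : ℝ} (hr : 0 < r)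
    {y n : (Fin 2 → ℝ) → Fin 3 → ℝ} (hU₁ : IsOpen U₁) (hω₁ : closure ω ⊆ U₁)
    (hy : ContDiffOn ℝ 3 y U₁) (hU₂ : IsOpen U₂) (hω₂ : closure ω ⊆ U₂) (hn : ContDiffOn ℝ 2 n U₂)
    (hunit : ∀ x, unit3 (n x))
    (hmetric : ∀ x ∈ ω, (jac32 y x)ᵀ * jac32 y x = ellT r (n x)) :
    ∃ (V : Set (Fin 2 → ℝ)) (b : (Fin 2 → ℝ) → Fin 3 → ℝ), IsOpen V ∧ closure ω ⊆ V ∧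
      ContDiffOn ℝ 3 y V ∧ ContDiffOn ℝ 2 b V ∧
      (∀ x ∈ V, (frame3 (partial2 y 0 x) (partial2 y 1 x) (b x)).det = 1) ∧
      ∀ x ∈ ω, (frame3 (partial2 y 0 x) (partial2 y 1 x) (b x))ᵀ *
        frame3 (partial2 y 0 x) (partial2 y 1 x) (b x) = ell r (n x) := by
  set D : (Fin 2 → ℝ) → ℝ := fun x => gramDet (partial2 y 0 x) (partial2 y 1 x)
  have hU : IsOpen (U₁ ∩ U₂) := hU₁.inter hU₂
  have hωU : closure ω ⊆ U₁ ∩ U₂ := Set.subset_inter hω₁ hω₂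
  have hyU := hy.mono (Set.inter_subset_left (t := U₂))
  have hnU := hn.mono (Set.inter_subset_right (s := U₁))
  have ha := hyU.partial2 hU (m := 2) (by norm_num)
  have hD : ContDiffOn ℝ 2 D (U₁ ∩ U₂) := (ha 0).gramDet (ha 1)
  set δ := (r ^ (-(1/3) : ℝ)) ^ 2 * min 1 r
  have hδ : 0 < δ := by positivity
  have hDω : ∀ x ∈ ω, δ ≤ D x := fun x hx =>
    gramDet_ge (hunit x) (gram_of_metric (hmetric x hx) 0 0) (gram_of_metric (hmetric x hx) 0 1)
      (gram_of_metric (hmetric x hx) 1 1)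
  have hDcl : ∀ x ∈ closure ω, δ ≤ D x := fun x hx =>
    le_on_closure hDω continuousOn_const (hD.continuousOn.mono hωU) hx
  set V := (U₁ ∩ U₂) ∩ D ⁻¹' {0}ᶜ
  have hV : IsOpen V := hD.continuousOn.isOpen_inter_preimage hU isOpen_compl_singleton
  have hVU : V ⊆ U₁ ∩ U₂ := Set.inter_subset_left
  have hell : ∀ i, ContDiffOn ℝ 2 (fun x => r ^ (-(1/3) : ℝ) * ((r - 1) * (n x i * n x 2))) V := by
    intro i
    have := contDiffOn_pi.1 (hnU.mono hVU)
    exact contDiffOn_const.mul (contDiffOn_const.mul ((this i).mul (this 2)))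
  refine ⟨V, fun x => transversal (partial2 y 0 x) (partial2 y 1 x) (ell r (n x) 0 2)
    (ell r (n x) 1 2), hV, fun x hx => ⟨hωU hx, ?_⟩, hyU.mono hVU, ?_, ?_, ?_⟩
  · exact (hδ.trans_le (hDcl x hx)).ne'
  · refine ((ha 0).mono hVU).transversal ((ha 1).mono hVU) ?_ ?_ fun x hx => hx.2
    · refine (hell 0).congr fun x _ => ?_
      simp [ell, outer3]
    · refine (hell 1).congr fun x _ => ?_
      simp [ell, outer3]
  · exact fun x hx => det_frame3_transversal hx.2 _ _
  · exact fun x hx => transpose_frame3_mul_eq_ell hr (hunit x) (hδ.trans_le (hDω x hx)).ne'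
      (gram_of_metric (hmetric x hx) 0 0) (gram_of_metric (hmetric x hx) 0 1)
      (gram_of_metric (hmetric x hx) 1 1)

lemma isOpen_slab {ω : Set (Fin 2 → ℝ)} (hω : IsOpen ω) (h : ℝ) : IsOpen (slab ω h) :=
  (hω.preimage continuous_proj2).inter (isOpen_Ioo.preimage (continuous_apply 2))

lemma closure_slab_subset (ω : Set (Fin 2 → ℝ)) (h : ℝ) :
    closure (slab ω h) ⊆ {x | proj2 x ∈ closure ω ∧ |x 2| ≤ h / 2} := by
  refine closure_minimal (fun x hx => ⟨subset_closure hx.1, abs_le.2 ⟨hx.2.1.le, hx.2.2.le⟩⟩) ?_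
  exact (isClosed_closure.preimage continuous_proj2).inter
    (isClosed_le (continuous_apply 2).abs continuous_const)

lemma volume_slab_le {ω : Set (Fin 2 → ℝ)} (hbd : Bornology.IsBounded ω) :
    ∃ A : ℝ, 0 ≤ A ∧ ∀ h : ℝ, 0 < h → volume (slab ω h) ≤ ENNReal.ofReal (A * h) := by
  obtain ⟨R, hR0, hR⟩ := hbd.subset_closedBall_lt 0 0
  refine ⟨(2 * R) * (2 * R), by positivity, fun h hh => ?_⟩
  have hsub : slab ω h ⊆ Set.Icc ![-R, -R, -(h / 2)] ![R, R, h / 2] := by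
    intro x hx
    have h1 : ∀ i : Fin 2, |x i.castSucc| ≤ R := fun i =>
      (norm_le_pi_norm (proj2 x) i).trans (by simpa using hR hx.1)
    have h2 : |x 0| ≤ R := h1 0
    have h3 : |x 1| ≤ R := h1 1
    rw [abs_le] at h2 h3
    have h4 := hx.2
    constructor
    · intro i; fin_cases i
      · exact h2.1
      · exact h3.1
      · exact h4.1.le
    · intro i; fin_cases i
      · exact h2.2
      · exact h3.2
      · exact h4.2.le
  refine (measure_mono hsub).trans (le_of_eq ?_)
  rw [Real.volume_Icc_pi, Fin.prod_univ_three, ← ENNReal.ofReal_mul (by simp; linarith),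
    ← ENNReal.ofReal_mul (by simp; nlinarith)]
  congr 1
  change (R - -R) * (R - -R) * (h / 2 - -(h / 2)) = _
  ring

lemma setIntegral_le_of_ae_le {α : Type*} [MeasurableSpace α] {ν : Measure α} {s : Set α}
    {f : α → ℝ} {c v : ℝ} (hc : 0 ≤ c) (hv : 0 ≤ v) (hs : ν s ≤ ENNReal.ofReal v)
    (hf : ∀ᵐ x ∂ν.restrict s, f x ≤ c) : ∫ x in s, f x ∂ν ≤ c * v := by
  have hfin : ν s ≠ ⊤ := ne_top_of_le_ne_top ENNReal.ofReal_ne_top hs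
  by_cases hi : IntegrableOn f s ν
  · have h1 : ∫ x in s, f x ∂ν ≤ ∫ _ in s, c ∂ν :=
      integral_mono_ae hi (integrableOn_const hfin) hf
    rw [setIntegral_const, smul_eq_mul, mul_comm] at h1
    exact h1.trans (mul_le_mul_of_nonneg_left (ENNReal.toReal_le_of_le_ofReal hv hs) hc)
  · rw [integral_undef hi]; positivity

/-- smooth surfaces are pure bending: if `y ∈ C³`, `n₀ ∈ C²` (on a
neighborhood of `closure ω`) satisfy the metric constraint `(∇̃y)ᵀ∇̃y = ℓ̃_{n₀}` on `ω`
with `r = r_f/r₀ ≠ 1`, then there are `C, h₀ > 0` such that for each `h ∈ (0,h₀)` there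
is an incompressible `C¹` extension `Y^h` of `y` with entropic energy at most `C h³` for
every admissible programmed director field `N₀^h`. -/
theorem statement16
    (ω : Set (Fin 2 → ℝ)) (hω : IsOpen ω) (hbd : Bornology.IsBounded ω) (hconn : IsConnected ω)
    (r0 rf μ τ : ℝ) (hr0 : 1 ≤ r0) (hrf : 1 ≤ rf) (hrne : rf / r0 ≠ 1) (hμ : 0 < μ) (hτ : 0 < τ)
    (y : (Fin 2 → ℝ) → Fin 3 → ℝ) (n0 : (Fin 2 → ℝ) → Fin 3 → ℝ)
    (hy : ∃ U, IsOpen U ∧ closure ω ⊆ U ∧ ContDiffOn ℝ 3 y U)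
    (hn : ∃ U, IsOpen U ∧ closure ω ⊆ U ∧ ContDiffOn ℝ 2 n0 U)
    (hunit : ∀ xt, unit3 (n0 xt))
    (hmetric : ∀ xt ∈ ω, (jac32 y xt)ᵀ * jac32 y xt = ellT (rf / r0) (n0 xt)) :
    ∃ C : ℝ, 0 < C ∧ ∃ h₀ : ℝ, 0 < h₀ ∧ ∀ h : ℝ, 0 < h → h < h₀ →
      ∃ Y : (Fin 3 → ℝ) → Fin 3 → ℝ,
        (∃ U, IsOpen U ∧ closure (slab ω h) ⊆ U ∧ ContDiffOn ℝ 1 Y U) ∧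
        (∀ xt ∈ ω, Y (emb xt 0) = y xt) ∧
        (∀ x ∈ slab ω h, (jac3 Y x).det = 1) ∧
        (∀ N0 : (Fin 3 → ℝ) → Fin 3 → ℝ, Measurable N0 →
          (∀ᵐ x ∂(volume.restrict (slab ω h)),
            unit3 (N0 x) ∧ ∑ i, (N0 x i - n0 (proj2 x) i) ^ 2 ≤ (τ * h) ^ 2) →
          (∫ x in slab ω h,
            We μ rf r0 (jac3 Y x) (nvec ((jac3 Y x).mulVec (N0 x))) (N0 x)) ≤ C * h ^ 3) := by
  have hr : 0 < rf / r0 := div_pos (by linarith) (by linarith)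
  obtain ⟨U₁, hU₁, hω₁, hyU⟩ := hy
  obtain ⟨U₂, hU₂, hω₂, hnU⟩ := hn
  obtain ⟨V, b, hV, hωV, hyV, hbV, hdet, hgram⟩ :=
    exists_transversal_field hr hU₁ hω₁ hyU hU₂ hω₂ hnU hunit hmetric
  have hK : IsCompact (closure ω) := hbd.isCompact_closure
  obtain ⟨Y, U, h₀, c, hU, hh₀, hc, hYU, hY0, hY⟩ :=
    exists_incompressible_extension hV hK hωV (hyV.of_le (by norm_num)) hbV hdet
  let F0 : (Fin 2 → ℝ) → Matrix (Fin 3) (Fin 3) ℝ :=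
    fun x => frame3 (partial2 y 0 x) (partial2 y 1 x) (b x)
  obtain ⟨L, hL, hF0⟩ : ∃ L : ℝ, 0 ≤ L ∧ ∀ x ∈ closure ω, ∀ i j, |F0 x i j| ≤ L := by
    have ha := hyV.partial2 hV (m := 2) (by norm_num)
    obtain ⟨L0, hL0⟩ := hK.exists_bound_of_continuousOn ((ha 0).continuousOn.mono hωV)
    obtain ⟨L1, hL1⟩ := hK.exists_bound_of_continuousOn ((ha 1).continuousOn.mono hωV)
    obtain ⟨L2, hL2⟩ := hK.exists_bound_of_continuousOn (hbV.continuousOn.mono hωV)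
    refine ⟨max 0 (max L0 (max L1 L2)), le_max_left _ _, fun x hx i j => ?_⟩
    fin_cases j
    · exact ((norm_le_pi_norm _ i).trans (hL0 x hx)).trans (by simp)
    · exact ((norm_le_pi_norm _ i).trans (hL1 x hx)).trans (by simp)
    · exact ((norm_le_pi_norm _ i).trans (hL2 x hx)).trans (by simp)
  obtain ⟨Q, hQ, hWe⟩ := We_quadratic hμ hrf hr0 hL hc hτ.le
  obtain ⟨A, hA, hvol⟩ := volume_slab_le hbd
  refine ⟨Q * A + 1, by positivity, min 1 h₀, lt_min one_pos hh₀, fun h hh hlt => ?_⟩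
  have hh1 : h < 1 := hlt.trans_le (min_le_left _ _)
  have hhh₀ : h < h₀ := hlt.trans_le (min_le_right _ _)
  have hslab : ∀ x ∈ slab ω h, proj2 x ∈ closure ω ∧ |x 2| ≤ h / 2 := fun x hx =>
    closure_slab_subset ω h (subset_closure hx)
  refine ⟨Y, ⟨U, hU, fun x hx => ?_, hYU⟩, fun xt _ => hY0 xt, fun x hx => ?_, ?_⟩
  · have := closure_slab_subset ω h hx
    exact (hY h hh hhh₀ x this.1 this.2).1
  · exact (hY h hh hhh₀ x (hslab x hx).1 (hslab x hx).2).2.1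
  intro N0 _ hN0
  have hae : ∀ᵐ x ∂(volume.restrict (slab ω h)),
      We μ rf r0 (jac3 Y x) (nvec ((jac3 Y x).mulVec (N0 x))) (N0 x) ≤ Q * h ^ 2 := by
    filter_upwards [hN0, ae_restrict_mem (isOpen_slab hω h).measurableSet] with x hx hxs
    obtain ⟨-, hd, hF⟩ := hY h hh hhh₀ x (hslab x hxs).1 (hslab x hxs).2
    refine hWe h hh hh1.le _ (F0 (proj2 x)) _ (n0 (proj2 x)) hx.1 (hunit _) hd
      (hgram _ hxs.1) (hF0 _ (hslab x hxs).1) hF fun i => ?_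
    refine abs_le_of_sq_le_sq (le_trans ?_ hx.2) (by positivity)
    exact Finset.single_le_sum (f := fun i => (N0 x i - n0 (proj2 x) i) ^ 2)
      (fun j _ => sq_nonneg _) (Finset.mem_univ i)
  refine (setIntegral_le_of_ae_le (by positivity) (by positivity) (hvol h hh) hae).trans ?_
  nlinarith [pow_pos hh 3]
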